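/- Let F(s,y) = (s + w(s)√y + O(y), y + O(y^{3/2})) be a C^∞-lifted strongly billiard-like map defined on U ∪ J, where J = (a,b)×{0} and U ⊂ ℝ×ℝ_{>0} is a domain adjacent to J. Let H = (H₁, H₂) be a C^∞-smooth diffeomorphism of U ∪ J onto its image in ℝ×ℝ_{≥0} conjugating F to the normal form Λ : (t,z) ↦ (t + √z, z), i.e. H∘F = Λ∘H. Fix s₀ ∈ (a,b) and set t_L(s) := ∫_{s₀}^{s} w(u)^{−2/3} du. Then: (1) H is orientation-preserving, H(J) ⊂ ℝ×{0}, and s ↦ H₁(s,0) is strictly increasing on (a,b); (2) if moreover H preserves the standard area form ds∧dy (H is symplectic), then H₁(s,0) = t_L(s) up to an additive constant; (3) in general, there exist α > 0 and β ∈ ℝ such that H₁(s,0) = α t_L(s) + β for all s ∈ (a,b). -/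

import Mathlib

open Set

/-- `J = (a,b) × {0} ⊂ ℝ²`. -/
def Jset (a b : ℝ) : Set (ℝ × ℝ) := Set.Ioo a b ×ˢ ({0} : Set ℝ)

/-- A domain (connected open set) in the upper half-plane adjacent to the
interval `J = (a,b) × {0}`. -/
def IsAdjDomain (a b : ℝ) (V : Set (ℝ × ℝ)) : Prop :=
  IsOpen V ∧ IsConnected V ∧ (∀ p ∈ V, 0 < p.2) ∧
    ∀ s ∈ Set.Ioo a b, ∃ ε > 0, Set.Ioo (s - ε) (s + ε) ×ˢ Set.Ioo (0 : ℝ) ε ⊆ V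

/-- A function `f` on `S` (typically `S = V ∪ J`) is `y`-flat: it vanishes on `J`,
and it tends to `0` together with each of its partial derivatives of every order,
as the second coordinate tends to `0`, uniformly on compact subsets of `(a,b)`. -/
def FlatOn (a b : ℝ) (S : Set (ℝ × ℝ)) (f : ℝ × ℝ → ℝ) : Prop :=
  (∀ s ∈ Set.Ioo a b, f (s, 0) = 0) ∧
  ∀ (n : ℕ) (K : Set ℝ), IsCompact K → K ⊆ Set.Ioo a b →
    ∀ ε > 0, ∃ δ > 0, ∀ p ∈ S, p.1 ∈ K → p.2 < δ →
      ‖iteratedFDerivWithin ℝ n f S p‖ < ε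

/-- A `C^∞`-lifted strongly billiard-like map `F` on `V ∪ J`, `J = (a,b) × {0}`,
with asymptotic coefficient `w`:
(i) `F` is a homeomorphism onto its image fixing the points of `J`;
(ii) `F|_V` is a `C^∞` diffeomorphism preserving the standard area form `ds ∧ dy`;
(iii) `F(s,y) = (s + w(s)√y + O(y), y + O(y^{3/2}))` as `y → 0`, uniformly on compact
subsets of `(a,b)`, with `w` continuous and positive;
(iv) in the coordinates `(s,z)`, `z = √y > 0`, the map `F` lifts to `F̃ = I ∘ β`,
where `I(s,z) = (s,−z)` and `β` is a `C^∞`-smooth involution on a neighborhood `N` of `J`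
fixing the points of `{z = 0}`, of the form `β(s,z) = (s + w(s)z + O(z²), −z + O(z²))`. -/
structure IsBilliardLike (a b : ℝ) (w : ℝ → ℝ) (V : Set (ℝ × ℝ))
    (F : ℝ × ℝ → ℝ × ℝ) : Prop where
  adj : IsAdjDomain a b V
  wCont : ContinuousOn w (Set.Ioo a b)
  wPos : ∀ s ∈ Set.Ioo a b, 0 < w s
  -- (i): homeomorphism onto the image, fixing the points of `J`
  fixJ : ∀ s ∈ Set.Ioo a b, F (s, 0) = (s, 0)
  mapsUpper : ∀ p ∈ V ∪ Jset a b, 0 ≤ (F p).2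
  contF : ContinuousOn F (V ∪ Jset a b)
  injF : Set.InjOn F (V ∪ Jset a b)
  contInv : ∃ G : ℝ × ℝ → ℝ × ℝ, ContinuousOn G (F '' (V ∪ Jset a b)) ∧
      ∀ p ∈ V ∪ Jset a b, G (F p) = p
  -- (ii): `F|_V` is a `C^∞` diffeomorphism preserving the area form
  smoothV : ContDiffOn ℝ (⊤ : ℕ∞) F V
  openImage : IsOpen (F '' V)
  smoothInv : ∃ G : ℝ × ℝ → ℝ × ℝ, ContDiffOn ℝ (⊤ : ℕ∞) G (F '' V) ∧
      ∀ p ∈ V, G (F p) = p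
  areaPres : ∀ p ∈ V, (fderiv ℝ F p).det = 1
  -- (iii): asymptotics `F(s,y) = (s + w(s)√y + O(y), y + O(y^{3/2}))`
  asymp : ∀ K : Set ℝ, IsCompact K → K ⊆ Set.Ioo a b →
      ∃ C > 0, ∃ δ > 0, ∀ p ∈ V, p.1 ∈ K → p.2 < δ →
        |(F p).1 - p.1 - w p.1 * Real.sqrt p.2| ≤ C * p.2 ∧
        |(F p).2 - p.2| ≤ C * p.2 ^ ((3:ℝ)/2)
  -- (iv): `C^∞`-smooth lifting `F̃ = I ∘ β` in the coordinates `(s, z)`, `z = √y`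
  lifted : ∃ N : Set (ℝ × ℝ), IsOpen N ∧ Jset a b ⊆ N ∧
      ∃ β : ℝ × ℝ → ℝ × ℝ, ContDiffOn ℝ (⊤ : ℕ∞) β N ∧
        (∀ p ∈ N, β p ∈ N ∧ β (β p) = p) ∧
        (∀ s ∈ Set.Ioo a b, β (s, 0) = (s, 0)) ∧
        (∀ K : Set ℝ, IsCompact K → K ⊆ Set.Ioo a b →
          ∃ C > 0, ∃ δ > 0, ∀ p ∈ N, p.1 ∈ K → |p.2| < δ →
            |(β p).1 - p.1 - w p.1 * p.2| ≤ C * p.2 ^ 2 ∧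
            |(β p).2 + p.2| ≤ C * p.2 ^ 2) ∧
        (∀ p ∈ N, 0 < p.2 → (p.1, p.2 ^ 2) ∈ V →
          (F (p.1, p.2 ^ 2)).1 = (β p).1 ∧
          Real.sqrt (F (p.1, p.2 ^ 2)).2 = -(β p).2)

theorem ContinuousLinearMap.det_real_prod (A : ℝ × ℝ →L[ℝ] ℝ × ℝ) :
    A.det = (A (1, 0)).1 * (A (0, 1)).2 - (A (0, 1)).1 * (A (1, 0)).2 := by
  rw [ContinuousLinearMap.det, ← LinearMap.det_toMatrix (Module.Basis.finTwoProd ℝ),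
    Matrix.det_fin_two]
  simp [LinearMap.toMatrix_apply]

theorem ContinuousLinearMap.det_comp_real_prod (A B : ℝ × ℝ →L[ℝ] ℝ × ℝ) :
    (A.comp B).det = A.det * B.det := by
  simp only [ContinuousLinearMap.det, ContinuousLinearMap.toLinearMap_comp, LinearMap.det_comp]

/-- The normal form `(t, z) ↦ (t + √z, z)` preserves area where `z > 0`. -/
theorem exists_hasFDerivAt_normalForm {q : ℝ × ℝ} (hq : 0 < q.2) :
    ∃ L : ℝ × ℝ →L[ℝ] ℝ × ℝ,
      HasFDerivAt (fun q : ℝ × ℝ => (q.1 + Real.sqrt q.2, q.2)) L q ∧ L.det = 1 := by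
  refine ⟨_, (hasFDerivAt_fst.add (hasFDerivAt_snd.sqrt hq.ne')).prodMk hasFDerivAt_snd, ?_⟩
  simp [ContinuousLinearMap.det_real_prod]

theorem IsAdjDomain.uniqueDiffWithinAt_boundary {a b : ℝ} {U : Set (ℝ × ℝ)} (hU : IsAdjDomain a b U)
    {s : ℝ} (hs : s ∈ Ioo a b) : UniqueDiffWithinAt ℝ U (s, 0) := by
  obtain ⟨ε, hε, hsub⟩ := hU.2.2.2 s hs
  refine UniqueDiffWithinAt.mono ?_ hsub
  refine uniqueDiffWithinAt_convex ((convex_Ioo _ _).prod (convex_Ioo _ _)) ?_ ?_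
  · rw [(isOpen_Ioo.prod isOpen_Ioo).interior_eq]
    exact ⟨(s, ε / 2), ⟨by simp [hε], by constructor <;> simp <;> linarith⟩⟩
  · rw [closure_prod_eq, closure_Ioo (by linarith), closure_Ioo (by linarith)]
    exact ⟨by constructor <;> simp <;> linarith, by simp [hε.le]⟩

theorem IsAdjDomain.uniqueDiffOn {a b : ℝ} {U : Set (ℝ × ℝ)} (hU : IsAdjDomain a b U) :
    UniqueDiffOn ℝ (U ∪ Jset a b) := by
  rintro p (hp | ⟨hs, h0⟩)
  · exact (hU.1.uniqueDiffWithinAt hp).mono subset_union_left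
  · obtain ⟨s, y⟩ := p
    obtain rfl : y = 0 := h0
    exact (hU.uniqueDiffWithinAt_boundary hs).mono subset_union_left

theorem IsAdjDomain.exists_vertical {a b : ℝ} {U : Set (ℝ × ℝ)} (hU : IsAdjDomain a b U)
    {s : ℝ} (hs : s ∈ Ioo a b) : ∃ ε > 0, ∀ y ∈ Ioo 0 ε, (s, y) ∈ U := by
  obtain ⟨ε, hε, hsub⟩ := hU.2.2.2 s hs
  exact ⟨ε, hε, fun y hy => hsub ⟨by simp [hε], hy⟩⟩

theorem tendsto_sq_nhdsGT_zero :
    Filter.Tendsto (fun r : ℝ => r ^ 2) (nhdsWithin 0 (Ioi 0)) (nhdsWithin 0 (Ioi 0)) := by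
  refine tendsto_nhdsWithin_iff.2 ⟨?_, ?_⟩
  · have : Continuous fun r : ℝ => r ^ 2 := by fun_prop
    simpa using (this.tendsto 0).mono_left nhdsWithin_le_nhds
  · filter_upwards [self_mem_nhdsWithin] with r hr
    exact pow_pos (mem_Ioi.1 hr) 2

theorem hasDerivWithinAt_zero_of_isBigO_sq {f : ℝ → ℝ} {t : Set ℝ}
    (h : f =O[nhdsWithin 0 t] fun r => r ^ 2) (h0 : f 0 = 0) : HasDerivWithinAt f 0 t 0 := by
  rw [hasDerivWithinAt_iff_isLittleO]
  simpa [h0] using h.trans_isLittleO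
    ((Asymptotics.isLittleO_pow_id one_lt_two).mono nhdsWithin_le_nhds)

/-- Over a point of the boundary interval, in the variable `r = √y`, the map `F` stays in the
domain for small `r > 0`, and `r ↦ F (s, r²)` leaves `(s, 0)` with velocity `(w s, 0)`. -/
theorem IsBilliardLike.exists_curve {a b : ℝ} {w : ℝ → ℝ} {U : Set (ℝ × ℝ)}
    {F : ℝ × ℝ → ℝ × ℝ} (hF : IsBilliardLike a b w U F) {s : ℝ} (hs : s ∈ Ioo a b) :
    ∃ δ > 0, (∀ r ∈ Ioo 0 δ, (s, r ^ 2) ∈ U ∧ F (s, r ^ 2) ∈ U) ∧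
      HasDerivWithinAt (fun r : ℝ => F (s, r ^ 2)) (w s, 0) (Ioo 0 δ) 0 := by
  obtain ⟨ε, hε, hsub⟩ := hF.adj.2.2.2 s hs
  obtain ⟨C, hC, δ, hδ, hb⟩ := hF.asymp {s} isCompact_singleton (by simpa using hs)
  have hbound : ∀ r : ℝ, 0 < r → r ^ 2 < ε → r ^ 2 < δ →
      (s, r ^ 2) ∈ U ∧ |(F (s, r ^ 2)).1 - s - w s * r| ≤ C * r ^ 2 ∧
        |(F (s, r ^ 2)).2 - r ^ 2| ≤ C * r ^ 3 := by
    intro r hr h1 h2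
    have hU : (s, r ^ 2) ∈ U := hsub ⟨by simp [hε], by positivity, h1⟩
    have := hb _ hU rfl h2
    rw [Real.sqrt_sq hr.le, ← Real.rpow_natCast_mul hr.le] at this
    norm_num at this
    exact ⟨hU, this.1, by exact_mod_cast this.2⟩
  have hsmall : ∀ᶠ r : ℝ in nhdsWithin 0 (Ioi 0), 0 < r ∧ r ^ 2 < ε ∧ r ^ 2 < δ := by
    have h0 := tendsto_nhds_of_tendsto_nhdsWithin tendsto_sq_nhdsGT_zero
    filter_upwards [self_mem_nhdsWithin, h0.eventually_lt_const hε, h0.eventually_lt_const hδ]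
      with r h1 h2 h3 using ⟨h1, h2, h3⟩
  have hd : HasDerivWithinAt (fun r : ℝ => F (s, r ^ 2)) (w s, 0) (Ioi 0) 0 := by
    have e1 : HasDerivWithinAt (fun r : ℝ => (F (s, r ^ 2)).1) (w s) (Ioi 0) 0 := by
      have h : (fun r : ℝ => (F (s, r ^ 2)).1 - s - w s * r) =O[nhdsWithin 0 (Ioi 0)]
          fun r => r ^ 2 := by
        refine Asymptotics.IsBigO.of_bound C ?_
        filter_upwards [hsmall] with r ⟨h1, h2, h3⟩
        simpa using (hbound r h1 h2 h3).2.1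
      have hz' := hasDerivWithinAt_zero_of_isBigO_sq h (by simp [hF.fixJ s hs])
      have := (hz'.add ((hasDerivAt_id (0 : ℝ)).const_mul (w s)).hasDerivWithinAt).const_add s
      simpa [id] using this
    have e2 : HasDerivWithinAt (fun r : ℝ => (F (s, r ^ 2)).2) 0 (Ioi 0) 0 := by
      have h : (fun r : ℝ => (F (s, r ^ 2)).2) =O[nhdsWithin 0 (Ioi 0)]
          fun r => r ^ 2 := by
        refine Asymptotics.IsBigO.of_bound (1 + C * (1 + ε)) ?_
        filter_upwards [hsmall] with r ⟨h1, h2, h3⟩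
        have h4 := (hbound r h1 h2 h3).2.2
        have h5 : r ≤ 1 + ε := by nlinarith
        have h6 : C * r ^ 3 ≤ C * (1 + ε) * r ^ 2 := by
          have := mul_le_mul_of_nonneg_left h5 (show 0 ≤ C * r ^ 2 by positivity)
          nlinarith
        have h7 := abs_sub_abs_le_abs_sub (F (s, r ^ 2)).2 (r ^ 2)
        rw [abs_of_pos (show 0 < r ^ 2 by positivity)] at h7
        simp only [Real.norm_eq_abs, sq_abs, abs_pow]
        linarith
      exact hasDerivWithinAt_zero_of_isBigO_sq h (by simp [hF.fixJ s hs])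
    exact e1.prodMk e2
  have hcont : Filter.Tendsto (fun r : ℝ => F (s, r ^ 2)) (nhdsWithin 0 (Ioi 0))
      (nhds (s, 0)) := by
    simpa [ContinuousWithinAt, hF.fixJ s hs] using hd.continuousWithinAt
  have hmem : ∀ᶠ r : ℝ in nhdsWithin 0 (Ioi 0), (s, r ^ 2) ∈ U ∧ F (s, r ^ 2) ∈ U := by
    have hN : Ioo (s - ε) (s + ε) ×ˢ Iio ε ∈ nhds (s, (0 : ℝ)) :=
      (isOpen_Ioo.prod isOpen_Iio).mem_nhds ⟨by simp [hε], hε⟩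
    have hC1 : ∀ᶠ r : ℝ in nhdsWithin 0 (Ioi 0), C * r < 1 := by
      have : Continuous fun r : ℝ => C * r := by fun_prop
      have := (this.tendsto 0).mono_left (nhdsWithin_le_nhds (s := Ioi 0))
      exact this.eventually_lt_const (by simp)
    filter_upwards [hsmall, hcont hN, hC1] with r ⟨h1, h2, h3⟩ h4 h5
    obtain ⟨h6, -, h7⟩ := hbound r h1 h2 h3
    refine ⟨h6, hsub ⟨h4.1, ?_, h4.2⟩⟩
    have := (abs_le.1 h7).1
    have : C * r * r ^ 2 < 1 * r ^ 2 := mul_lt_mul_of_pos_right h5 (by positivity)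
    nlinarith
  obtain ⟨d, hd0, hdsub⟩ := mem_nhdsGT_iff_exists_Ioo_subset.1 hmem
  exact ⟨d, hd0, fun r hr => hdsub hr, hd.mono fun r hr => hr.1⟩

theorem HasFDerivWithinAt.hasDerivAt_boundary {a b : ℝ} {U : Set (ℝ × ℝ)} {E : Type*}
    [NormedAddCommGroup E] [NormedSpace ℝ E] {f : ℝ × ℝ → E} {f' : ℝ × ℝ →L[ℝ] E} {s : ℝ}
    (hf : HasFDerivWithinAt f f' (U ∪ Jset a b) (s, 0)) (hs : s ∈ Ioo a b) :
    HasDerivAt (fun u => f (u, 0)) (f' (1, 0)) s := by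
  have hc : HasDerivWithinAt (fun u : ℝ => (u, (0 : ℝ))) (1, 0) (Ioo a b) s :=
    ((hasDerivAt_id s).prodMk (hasDerivAt_const s 0)).hasDerivWithinAt
  exact (hf.comp_hasDerivWithinAt s hc fun u hu => Or.inr ⟨hu, rfl⟩).hasDerivAt
    (isOpen_Ioo.mem_nhds hs)

theorem HasFDerivWithinAt.tendsto_vertical {a b : ℝ} {U : Set (ℝ × ℝ)}
    (hU : IsAdjDomain a b U) {f : ℝ × ℝ → ℝ} {f' : ℝ × ℝ →L[ℝ] ℝ} {s : ℝ}
    (hf : HasFDerivWithinAt f f' (U ∪ Jset a b) (s, 0)) (hs : s ∈ Ioo a b)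
    (h0 : f (s, 0) = 0) :
    Filter.Tendsto (fun y => f (s, y) / y) (nhdsWithin 0 (Ioi 0)) (nhds (f' (0, 1))) := by
  obtain ⟨ε, hε, hsub⟩ := hU.exists_vertical hs
  have hc : HasDerivWithinAt (fun y : ℝ => (s, y)) (0, 1) (Ioo 0 ε) 0 :=
    ((hasDerivAt_const (0 : ℝ) s).prodMk (hasDerivAt_id 0)).hasDerivWithinAt
  have := hf.comp_hasDerivWithinAt 0 hc fun y hy => Or.inl (hsub y hy)
  rw [hasDerivWithinAt_iff_tendsto_slope' (by simp), nhdsWithin_Ioo_eq_nhdsGT hε] at this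
  refine this.congr fun y => ?_
  simp [slope_def_field, h0]

/-- First-order expansion of `f ∘ F - f` at the boundary, in the variable `r = √y`. -/
theorem IsBilliardLike.tendsto_increment {a b : ℝ} {w : ℝ → ℝ} {U : Set (ℝ × ℝ)}
    {F : ℝ × ℝ → ℝ × ℝ} (hF : IsBilliardLike a b w U F) {f : ℝ × ℝ → ℝ}
    {f' : ℝ × ℝ →L[ℝ] ℝ} {s : ℝ} (hs : s ∈ Ioo a b)
    (hf : HasFDerivWithinAt f f' (U ∪ Jset a b) (s, 0)) :
    Filter.Tendsto (fun r : ℝ => (f (F (s, r ^ 2)) - f (s, r ^ 2)) / r)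
      (nhdsWithin 0 (Ioi 0)) (nhds (w s * f' (1, 0))) := by
  obtain ⟨δ, hδ, hmem, hd⟩ := hF.exists_curve hs
  have hc : HasDerivWithinAt (fun r : ℝ => (s, r ^ 2)) (0, 0) (Ioo 0 δ) 0 := by
    have := ((hasDerivAt_const (0 : ℝ) s).prodMk (hasDerivAt_pow 2 (0 : ℝ))).hasDerivWithinAt
      (s := Ioo 0 δ)
    simpa using this
  have h1 := HasFDerivWithinAt.comp_hasDerivWithinAt (0 : ℝ) (f := fun r : ℝ => F (s, r ^ 2))
    (by simpa [hF.fixJ s hs] using hf) hd fun r hr => Or.inl (hmem r hr).2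
  have h2 := HasFDerivWithinAt.comp_hasDerivWithinAt (0 : ℝ) (f := fun r : ℝ => (s, r ^ 2))
    (by simpa using hf) hc fun r hr => Or.inl (hmem r hr).1
  have h3 := h1.sub h2
  rw [hasDerivWithinAt_iff_tendsto_slope' (by simp), nhdsWithin_Ioo_eq_nhdsGT hδ] at h3
  have hw : f' (w s, 0) - f' (0, 0) = w s * f' (1, 0) := by
    have : ((w s, 0) : ℝ × ℝ) = w s • (1, 0) := by simp
    rw [this, map_smul, smul_eq_mul, Prod.mk_zero_zero, map_zero, sub_zero]
  rw [hw] at h3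
  refine h3.congr fun r => ?_
  simp [slope_def_field, hF.fixJ s hs]

theorem det_fderivWithin_ne_zero_of_leftInverse {S : Set (ℝ × ℝ)} (hS : UniqueDiffOn ℝ S)
    {H G : ℝ × ℝ → ℝ × ℝ} (hH : DifferentiableOn ℝ H S) (hG : DifferentiableOn ℝ G (H '' S))
    (hGH : ∀ p ∈ S, G (H p) = p) {p : ℝ × ℝ} (hp : p ∈ S) :
    (fderivWithin ℝ H S p).det ≠ 0 := by
  have h1 := (hG (H p) (mem_image_of_mem H hp)).hasFDerivWithinAt.comp p
    (hH p hp).hasFDerivWithinAt (mapsTo_image H S)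
  have h2 : HasFDerivWithinAt (G ∘ H) (ContinuousLinearMap.id ℝ (ℝ × ℝ)) S p :=
    (hasFDerivWithinAt_id p S).congr hGH (hGH p hp)
  have h3 := congrArg ContinuousLinearMap.det ((hS p hp).eq h1 h2)
  rw [ContinuousLinearMap.det_comp_real_prod] at h3
  intro h0
  simp [h0, ContinuousLinearMap.det_real_prod] at h3

theorem ContDiffOn.differentiableOn_det_fderivWithin {S : Set (ℝ × ℝ)} (hS : UniqueDiffOn ℝ S)
    {H : ℝ × ℝ → ℝ × ℝ} (hH : ContDiffOn ℝ (⊤ : ℕ∞) H S) :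
    DifferentiableOn ℝ (fun p => (fderivWithin ℝ H S p).det) S := by
  have h : DifferentiableOn ℝ (fderivWithin ℝ H S) S :=
    ((contDiffOn_infty_iff_fderivWithin hS).1 hH).2.differentiableOn (by simp)
  simp only [ContinuousLinearMap.det_real_prod]
  fun_prop

section Conjugacy

variable {a b : ℝ} {w : ℝ → ℝ} {U : Set (ℝ × ℝ)} {F H : ℝ × ℝ → ℝ × ℝ}

theorem snd_eq_zero_of_conj (hF : IsBilliardLike a b w U F)
    (hHmaps : ∀ p ∈ U ∪ Jset a b, 0 ≤ (H p).2)
    (hconj : ∀ p ∈ U ∪ Jset a b, F p ∈ U ∪ Jset a b →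
      H (F p) = ((H p).1 + Real.sqrt (H p).2, (H p).2))
    {s : ℝ} (hs : s ∈ Ioo a b) : (H (s, 0)).2 = 0 := by
  have hJ : (s, (0 : ℝ)) ∈ U ∪ Jset a b := Or.inr ⟨hs, rfl⟩
  have h := congrArg Prod.fst (hconj _ hJ (by rwa [hF.fixJ s hs]))
  rw [hF.fixJ s hs] at h
  exact (Real.sqrt_eq_zero (hHmaps _ hJ)).1 (by simpa using h)

/-- The `1`-jet of a conjugacy to the normal form along the boundary: comparing the terms of
order `√y` in `H₁ ∘ F - H₁ = √H₂` gives `∂_y H₂ = (w ∂_s H₁)²`. -/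
theorem fderivWithin_boundary_of_conj (hF : IsBilliardLike a b w U F)
    (hH : DifferentiableOn ℝ H (U ∪ Jset a b))
    (hdet : ∀ p ∈ U ∪ Jset a b, (fderivWithin ℝ H (U ∪ Jset a b) p).det ≠ 0)
    (hHmaps : ∀ p ∈ U ∪ Jset a b, 0 ≤ (H p).2)
    (hconj : ∀ p ∈ U ∪ Jset a b, F p ∈ U ∪ Jset a b →
      H (F p) = ((H p).1 + Real.sqrt (H p).2, (H p).2))
    {s : ℝ} (hs : s ∈ Ioo a b) :
    0 < (fderivWithin ℝ H (U ∪ Jset a b) (s, 0) (1, 0)).1 ∧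
      (fderivWithin ℝ H (U ∪ Jset a b) (s, 0) (0, 1)).2 =
        (w s * (fderivWithin ℝ H (U ∪ Jset a b) (s, 0) (1, 0)).1) ^ 2 ∧
      (fderivWithin ℝ H (U ∪ Jset a b) (s, 0)).det =
        w s ^ 2 * (fderivWithin ℝ H (U ∪ Jset a b) (s, 0) (1, 0)).1 ^ 3 := by
  have hJ : (s, (0 : ℝ)) ∈ U ∪ Jset a b := Or.inr ⟨hs, rfl⟩
  have hd := (hH _ hJ).hasFDerivWithinAt
  have hne := hdet _ hJ
  set D := fderivWithin ℝ H (U ∪ Jset a b) (s, 0)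
  have hz : ∀ u ∈ Ioo a b, (H (u, 0)).2 = 0 := fun u => snd_eq_zero_of_conj hF hHmaps hconj
  have hs2 : (D (1, 0)).2 = 0 := by
    refine (hd.snd.hasDerivAt_boundary hs).unique ?_
    refine (hasDerivAt_const s (0 : ℝ)).congr_of_eventuallyEq ?_
    filter_upwards [isOpen_Ioo.mem_nhds hs] with u hu using hz u hu
  obtain ⟨δ, hδ, hmem, -⟩ := hF.exists_curve hs
  have hev : ∀ᶠ r : ℝ in nhdsWithin 0 (Ioi 0), r ∈ Ioo 0 δ := Ioo_mem_nhdsGT hδ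
  have hinc : Filter.Tendsto (fun r : ℝ => Real.sqrt (H (s, r ^ 2)).2 / r)
      (nhdsWithin 0 (Ioi 0)) (nhds (w s * (D (1, 0)).1)) := by
    refine (hF.tendsto_increment hs hd.fst).congr' ?_
    filter_upwards [hev] with r hr
    obtain ⟨h1, h2⟩ := hmem r hr
    rw [hconj _ (Or.inl h1) (Or.inl h2)]
    simp
  have hy : (D (0, 1)).2 = (w s * (D (1, 0)).1) ^ 2 := by
    refine tendsto_nhds_unique
      ((hd.snd.tendsto_vertical hF.adj hs (hz s hs)).comp
        tendsto_sq_nhdsGT_zero) ((hinc.pow 2).congr' ?_)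
    filter_upwards [hev] with r hr
    rw [div_pow, Real.sq_sqrt (hHmaps _ (Or.inl (hmem r hr).1))]
    rfl
  have hdet' : D.det = w s ^ 2 * (D (1, 0)).1 ^ 3 := by
    rw [ContinuousLinearMap.det_real_prod, hs2, hy]
    ring
  refine ⟨?_, hy, hdet'⟩
  have h0 : 0 ≤ w s * (D (1, 0)).1 := by
    refine ge_of_tendsto hinc ?_
    filter_upwards [hev] with r hr
    exact div_nonneg (Real.sqrt_nonneg _) hr.1.le
  refine lt_of_le_of_ne (nonneg_of_mul_nonneg_right h0 (hF.wPos s hs)) fun h => hne ?_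
  rw [hdet', ← h]
  ring

/-- The Jacobian of a conjugacy between two area-preserving maps is invariant. -/
theorem det_fderiv_comp_of_conj (hF : IsBilliardLike a b w U F) (hH : DifferentiableOn ℝ H U)
    (hconj : ∀ p ∈ U, F p ∈ U → H (F p) = ((H p).1 + Real.sqrt (H p).2, (H p).2))
    {p : ℝ × ℝ} (hp : p ∈ U) (hFp : F p ∈ U) (hpos : 0 < (H p).2) :
    (fderiv ℝ H (F p)).det = (fderiv ℝ H p).det := by
  have hUo := hF.adj.1
  have dF : DifferentiableAt ℝ F p :=
    (hF.smoothV.differentiableOn (by simp)).differentiableAt (hUo.mem_nhds hp)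
  have dH : ∀ q ∈ U, HasFDerivAt H (fderiv ℝ H q) q := fun q hq =>
    (hH.differentiableAt (hUo.mem_nhds hq)).hasFDerivAt
  obtain ⟨L, hL, hL1⟩ := exists_hasFDerivAt_normalForm hpos
  have h1 := (dH _ hFp).comp p dF.hasFDerivAt
  have h2 := hL.comp p (dH p hp)
  have h3 : H ∘ F =ᶠ[nhds p] (fun q : ℝ × ℝ => (q.1 + Real.sqrt q.2, q.2)) ∘ H := by
    filter_upwards [hUo.mem_nhds hp, dF.continuousAt (hUo.mem_nhds hFp)] with q hq hFq
      using hconj q hq hFq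
  have h4 := congrArg ContinuousLinearMap.det (h1.unique (h2.congr_of_eventuallyEq h3))
  rwa [ContinuousLinearMap.det_comp_real_prod, ContinuousLinearMap.det_comp_real_prod,
    hF.areaPres p hp, hL1, mul_one, one_mul] at h4

/-- A differentiable function which is invariant under a strongly billiard-like map near the
boundary interval is constant on that interval. -/
theorem IsBilliardLike.eq_on_boundary_of_invariant (hF : IsBilliardLike a b w U F)
    {f : ℝ × ℝ → ℝ} (hf : DifferentiableOn ℝ f (U ∪ Jset a b))
    (hinv : ∀ s ∈ Ioo a b, ∀ᶠ r : ℝ in nhdsWithin 0 (Ioi 0), f (F (s, r ^ 2)) = f (s, r ^ 2))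
    {s u : ℝ} (hs : s ∈ Ioo a b) (hu : u ∈ Ioo a b) : f (s, 0) = f (u, 0) := by
  have hder : ∀ v ∈ Ioo a b, HasDerivAt (fun v => f (v, 0)) 0 v := by
    intro v hv
    have hd := (hf (v, 0) (Or.inr ⟨hv, rfl⟩)).hasFDerivWithinAt
    have h0 : w v * fderivWithin ℝ f (U ∪ Jset a b) (v, 0) (1, 0) = 0 := by
      refine tendsto_nhds_unique (hF.tendsto_increment hv hd) (tendsto_const_nhds.congr' ?_)
      filter_upwards [hinv v hv] with r hr
      simp [hr]
    have h1 := hd.hasDerivAt_boundary hv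
    rwa [(mul_eq_zero.1 h0).resolve_left (hF.wPos v hv).ne'] at h1
  exact isOpen_Ioo.is_const_of_deriv_eq_zero isPreconnected_Ioo
    (fun v hv => (hder v hv).differentiableAt.differentiableWithinAt)
    (fun v hv => (hder v hv).deriv) hs hu

end Conjugacy

/-- Integration of `w² (h')³ = c` on an interval. -/
theorem eq_mul_integral_rpow_add_of_sq_mul_cube_eq {a b : ℝ} {w h h' : ℝ → ℝ} {c s₀ : ℝ}
    (hw : ContinuousOn w (Ioo a b)) (hwpos : ∀ s ∈ Ioo a b, 0 < w s)
    (hh : ∀ s ∈ Ioo a b, HasDerivAt h (h' s) s) (hpos : ∀ s ∈ Ioo a b, 0 < h' s)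
    (hc : ∀ s ∈ Ioo a b, w s ^ 2 * h' s ^ 3 = c) (hs₀ : s₀ ∈ Ioo a b)
    {s : ℝ} (hs : s ∈ Ioo a b) :
    h s = c ^ ((1 : ℝ) / 3) * (∫ u in s₀..s, w u ^ (-(2 : ℝ) / 3)) + h s₀ := by
  have hsub : uIcc s₀ s ⊆ Ioo a b := ordConnected_Ioo.uIcc_subset hs₀ hs
  have hval : ∀ u ∈ Ioo a b, h' u = c ^ ((1 : ℝ) / 3) * w u ^ (-(2 : ℝ) / 3) := by
    intro u hu
    have h1 := hwpos u hu
    have h2 := hpos u hu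
    rw [← hc u hu, Real.mul_rpow (by positivity) (by positivity), ← Real.rpow_natCast_mul h1.le,
      ← Real.rpow_natCast_mul h2.le, mul_right_comm, ← Real.rpow_add h1]
    norm_num
  have hint : IntervalIntegrable (fun u => c ^ ((1 : ℝ) / 3) * w u ^ (-(2 : ℝ) / 3))
      MeasureTheory.volume s₀ s := by
    refine ContinuousOn.intervalIntegrable (continuousOn_const.mul ?_)
    exact (hw.mono hsub).rpow_const fun u hu => Or.inl (hwpos u (hsub hu)).ne'
  have := intervalIntegral.integral_eq_sub_of_hasDerivAt
    (fun u hu => hval u (hsub hu) ▸ hh u (hsub hu)) hint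
  rw [intervalIntegral.integral_const_mul] at this
  linarith

/-- Let `F` be a `C^∞`-lifted strongly billiard-like map on `U ∪ J`,
`J = (a,b) × {0}`, with asymptotic coefficient `w`. Let `H = (H₁,H₂)` be a `C^∞`
diffeomorphism of `U ∪ J` onto its image in `ℝ × ℝ_{≥0}` conjugating `F` to the normal
form `Λ : (t,z) ↦ (t + √z, z)`. With `t_L(s) = ∫_{s₀}^s w(u)^{−2/3} du` (the Lazutkin
parameter), we have: (1) `H` is orientation-preserving, `H(J) ⊂ ℝ × {0}`, and
`s ↦ H₁(s,0)` is strictly increasing; (2) if `H` is symplectic, then `H₁(s,0) = t_L(s)`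
up to an additive constant; (3) in general `H₁(s,0) = α t_L(s) + β` with `α > 0`. -/
theorem statement12 (a b : ℝ) (hab : a < b) (w : ℝ → ℝ) (U : Set (ℝ × ℝ))
    (F : ℝ × ℝ → ℝ × ℝ) (hF : IsBilliardLike a b w U F)
    (H : ℝ × ℝ → ℝ × ℝ)
    (hHsmooth : ContDiffOn ℝ (⊤ : ℕ∞) H (U ∪ Jset a b))
    (hHinj : Set.InjOn H (U ∪ Jset a b))
    (hHmaps : ∀ p ∈ U ∪ Jset a b, 0 ≤ (H p).2)
    (hHinv : ∃ G : ℝ × ℝ → ℝ × ℝ, ContDiffOn ℝ (⊤ : ℕ∞) G (H '' (U ∪ Jset a b)) ∧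
      ∀ p ∈ U ∪ Jset a b, G (H p) = p)
    (hconj : ∀ p ∈ U ∪ Jset a b, F p ∈ U ∪ Jset a b →
      H (F p) = ((H p).1 + Real.sqrt (H p).2, (H p).2))
    (s₀ : ℝ) (hs₀ : s₀ ∈ Set.Ioo a b) :
    -- (1) orientation-preserving, `H(J) ⊂ ℝ × {0}`, `H₁(·,0)` strictly increasing
    (∀ p ∈ U, 0 < (fderiv ℝ H p).det) ∧
    (∀ s ∈ Set.Ioo a b, (H (s, 0)).2 = 0) ∧
    StrictMonoOn (fun s => (H (s, 0)).1) (Set.Ioo a b) ∧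
    -- (2) if `H` is symplectic then `H₁(s,0) = t_L(s)` up to an additive constant
    ((∀ p ∈ U, (fderiv ℝ H p).det = 1) →
      ∃ c : ℝ, ∀ s ∈ Set.Ioo a b,
        (H (s, 0)).1 = (∫ u in s₀..s, (w u) ^ (-(2:ℝ)/3)) + c) ∧
    -- (3) in general `H₁(s,0) = α t_L(s) + β`, `α > 0`
    (∃ α : ℝ, 0 < α ∧ ∃ β : ℝ, ∀ s ∈ Set.Ioo a b,
      (H (s, 0)).1 = α * (∫ u in s₀..s, (w u) ^ (-(2:ℝ)/3)) + β) := by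
  have hadj := hF.adj
  have hUD := hadj.uniqueDiffOn
  have hHd : DifferentiableOn ℝ H (U ∪ Jset a b) := hHsmooth.differentiableOn (by simp)
  obtain ⟨G, hG, hGH⟩ := hHinv
  have hdet : ∀ p ∈ U ∪ Jset a b, (fderivWithin ℝ H (U ∪ Jset a b) p).det ≠ 0 := fun p hp =>
    det_fderivWithin_ne_zero_of_leftInverse hUD hHd (hG.differentiableOn (by simp)) hGH hp
  have hdetU : ∀ p ∈ U, fderivWithin ℝ H (U ∪ Jset a b) p = fderiv ℝ H p := fun p hp =>
    fderivWithin_of_mem_nhds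
      (Filter.mem_of_superset (hadj.1.mem_nhds hp) subset_union_left)
  have hφ := hHsmooth.differentiableOn_det_fderivWithin hUD
  have hz : ∀ s ∈ Ioo a b, (H (s, 0)).2 = 0 := fun s => snd_eq_zero_of_conj hF hHmaps hconj
  have hjet := fun s (hs : s ∈ Ioo a b) =>
    fderivWithin_boundary_of_conj hF hHd hdet hHmaps hconj hs
  have hder : ∀ s ∈ Ioo a b, HasDerivAt (fun u => (H (u, 0)).1)
      (fderivWithin ℝ H (U ∪ Jset a b) (s, 0) (1, 0)).1 s := fun s hs =>
    (hHd (s, 0) (Or.inr ⟨hs, rfl⟩)).hasFDerivWithinAt.fst.hasDerivAt_boundary hs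
  have hvert : ∀ s ∈ Ioo a b, Filter.Tendsto
      (fun y : ℝ => (fderivWithin ℝ H (U ∪ Jset a b) (s, y)).det) (nhdsWithin 0 (Ioi 0))
      (nhds (fderivWithin ℝ H (U ∪ Jset a b) (s, 0)).det) := by
    intro s hs
    obtain ⟨ε, hε, hsub⟩ := hadj.exists_vertical hs
    have hc : ContinuousWithinAt (fun y : ℝ => (s, y)) (Ioo 0 ε) 0 := by fun_prop
    have := ContinuousWithinAt.comp (x := (0 : ℝ)) (f := fun y : ℝ => (s, y))
      (hφ (s, 0) (Or.inr ⟨hs, rfl⟩)).continuousWithinAt hc fun y hy => Or.inl (hsub y hy)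
    rw [ContinuousWithinAt, nhdsWithin_Ioo_eq_nhdsGT hε] at this
    exact this
  have hvertU : ∀ s ∈ Ioo a b, ∀ᶠ y : ℝ in nhdsWithin 0 (Ioi 0), (s, y) ∈ U := by
    intro s hs
    obtain ⟨ε, hε, hsub⟩ := hadj.exists_vertical hs
    exact Filter.mem_of_superset (Ioo_mem_nhdsGT hε) hsub
  have hinv : ∀ s ∈ Ioo a b, ∀ᶠ r : ℝ in nhdsWithin 0 (Ioi 0),
      (fderivWithin ℝ H (U ∪ Jset a b) (F (s, r ^ 2))).det =
        (fderivWithin ℝ H (U ∪ Jset a b) (s, r ^ 2)).det := by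
    intro s hs
    obtain ⟨δ, hδ, hmem, -⟩ := hF.exists_curve hs
    have hg : 0 < (fderivWithin ℝ H (U ∪ Jset a b) (s, 0) (0, 1)).2 := by
      rw [(hjet s hs).2.1]
      exact pow_pos (mul_pos (hF.wPos s hs) (hjet s hs).1) 2
    have hlim := (HasFDerivWithinAt.tendsto_vertical hadj
      (hHd (s, 0) (Or.inr ⟨hs, rfl⟩)).hasFDerivWithinAt.snd hs (hz s hs)).comp
      tendsto_sq_nhdsGT_zero
    filter_upwards [Ioo_mem_nhdsGT hδ, hlim.eventually_const_lt hg] with r hr hpos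
    obtain ⟨h1, h2⟩ := hmem r hr
    rw [hdetU _ h1, hdetU _ h2]
    refine det_fderiv_comp_of_conj hF (hHd.mono subset_union_left)
      (fun p hp hFp => hconj p (Or.inl hp) (Or.inl hFp)) h1 h2 ?_
    exact (div_pos_iff_of_pos_right (pow_pos hr.1 2)).1 hpos
  have hconst : ∀ s ∈ Ioo a b, w s ^ 2 * (fderivWithin ℝ H (U ∪ Jset a b) (s, 0) (1, 0)).1 ^ 3 =
      w s₀ ^ 2 * (fderivWithin ℝ H (U ∪ Jset a b) (s₀, 0) (1, 0)).1 ^ 3 := by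
    intro s hs
    rw [← (hjet s hs).2.2, ← (hjet s₀ hs₀).2.2]
    exact hF.eq_on_boundary_of_invariant hφ hinv hs hs₀
  have hformula := fun s (hs : s ∈ Ioo a b) => eq_mul_integral_rpow_add_of_sq_mul_cube_eq
    hF.wCont hF.wPos hder (fun u hu => (hjet u hu).1) hconst hs₀ hs
  have hc₀ : 0 < w s₀ ^ 2 * (fderivWithin ℝ H (U ∪ Jset a b) (s₀, 0) (1, 0)).1 ^ 3 :=
    mul_pos (pow_pos (hF.wPos s₀ hs₀) 2) (pow_pos (hjet s₀ hs₀).1 3)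
  refine ⟨?_, hz, ?_, ?_, ?_⟩
  · intro p hp
    rw [← hdetU p hp]
    by_contra! hneg
    have h1 := (hvert s₀ hs₀).eventually_const_lt ((hjet s₀ hs₀).2.2 ▸ hc₀)
    obtain ⟨y, hy, hyU⟩ := (h1.and (hvertU s₀ hs₀)).exists
    obtain ⟨q, hq, hq0⟩ := hadj.2.1.isPreconnected.intermediate_value hp hyU
      (hφ.continuousOn.mono subset_union_left) ⟨hneg, hy.le⟩
    exact hdet q (Or.inl hq) hq0
  · refine strictMonoOn_of_deriv_pos (convex_Ioo a b)
      (fun s hs => (hder s hs).continuousAt.continuousWithinAt) fun s hs => ?_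
    rw [interior_Ioo] at hs
    rw [(hder s hs).deriv]
    exact (hjet s hs).1
  · intro hsymp
    have h1 : w s₀ ^ 2 * (fderivWithin ℝ H (U ∪ Jset a b) (s₀, 0) (1, 0)).1 ^ 3 = 1 := by
      rw [← (hjet s₀ hs₀).2.2]
      refine tendsto_nhds_unique (hvert s₀ hs₀) (tendsto_const_nhds.congr' ?_)
      filter_upwards [hvertU s₀ hs₀] with y hy
      rw [hdetU _ hy, hsymp _ hy]
    refine ⟨(H (s₀, 0)).1, fun s hs => ?_⟩
    simpa [h1] using hformula s hs
  · exact ⟨_, Real.rpow_pos_of_pos hc₀ _, _, hformula⟩
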